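/- Fix an integer p ≥ 1, t ∈ (0,1), and a compact set K contained in the open chamber { x ∈ ℝ^p : 0 < x_1 < ⋯ < x_p }. Then there exist C > 0 and n₀ such that for all n ≥ n₀ and all x ∈ K with x_i·√(2n) ∈ ℤ and x_i·√(2n) ≡ ⌊2nt⌋ (mod 2) for every i, one has | P( W_i(⌊2nt⌋) = x_i·√(2n) for all i ) / ( (2/n)^{p/2} · f(t;x) ) − 1 | ≤ C/√n, where P is the uniform probability on (p,2n)-watermelons with wall condition. -/

import Mathlib

open MeasureTheory Filter

/-- A star of length `m` with wall condition, with `p` branches, encoded as a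
function `Fin p → ℕ → ℤ` (values beyond time `m` are pinned to `0` so that the
collection of stars is a finite set). Branch `i` (0-indexed) starts at `2i`. -/
def IsStarW (p m : ℕ) (w : Fin p → ℕ → ℤ) : Prop :=
  (∀ i : Fin p, w i 0 = 2 * ((i : ℕ) : ℤ)) ∧
  (∀ i : Fin p, ∀ k, k < m → (w i (k + 1) - w i k = 1 ∨ w i (k + 1) - w i k = -1)) ∧
  (∀ i : Fin p, ∀ k, k ≤ m → 0 ≤ w i k) ∧
  (∀ i j : Fin p, i < j → ∀ k, k ≤ m → w i k < w j k) ∧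
  (∀ i : Fin p, ∀ k, m < k → w i k = 0)

/-- A `(p,2n)`-watermelon with wall condition. -/
def IsMelonW (p n : ℕ) (w : Fin p → ℕ → ℤ) : Prop :=
  IsStarW p (2 * n) w ∧ ∀ i : Fin p, w i (2 * n) = 2 * ((i : ℕ) : ℤ)

/-- Probability of the event `E` under the uniform distribution on
`(p,2n)`-watermelons with wall condition. -/
noncomputable def probW (p n : ℕ) (E : (Fin p → ℕ → ℤ) → Prop) : ℝ :=
  (Nat.card {w : Fin p → ℕ → ℤ // IsMelonW p n w ∧ E w} : ℝ) /
    (Nat.card {w : Fin p → ℕ → ℤ // IsMelonW p n w} : ℝ)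

/-- The normalizing constant `c_p` (indices `i < j` here are 0-indexed, so the
paper's `(j−i)(j+i−1)` becomes `(j−i)(j+i+1)`). -/
noncomputable def cW (p : ℕ) : ℝ :=
  2 ^ ((3 * (p : ℝ)) / 2) * (Nat.factorial p : ℝ) /
    ((Nat.factorial (2 * p) : ℝ) * Real.pi ^ ((p : ℝ) / 2) *
      ∏ i : Fin p, ∏ j ∈ Finset.Ioi i, ((((j : ℕ) : ℝ) - ((i : ℕ) : ℝ)) *
        (((j : ℕ) : ℝ) + ((i : ℕ) : ℝ) + 1)))

open Classical in
/-- The density `f(t;x)` of the continuous `p`-watermelon with wall condition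
at time `t`. -/
noncomputable def fW (p : ℕ) (t : ℝ) (x : Fin p → ℝ) : ℝ :=
  if (∀ i, 0 ≤ x i) ∧ (∀ i j : Fin p, i ≤ j → x i ≤ x j) then
    cW p * (t * (1 - t)) ^ (-(((p : ℝ) ^ 2) + (p : ℝ) / 2)) *
      (∏ i : Fin p, ∏ j ∈ Finset.Ioi i, ((x j) ^ 2 - (x i) ^ 2) ^ 2) *
      (∏ i : Fin p, (x i) ^ 2) *
      Real.exp (-(∑ i, (x i) ^ 2) / (2 * t * (1 - t)))
  else 0

/-- The stars of length `m` whose branches end at the heights `e`. -/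
abbrev StarTo (p m : ℕ) (e : Fin p → ℤ) : Type :=
  {w : Fin p → ℕ → ℤ // IsStarW p m w ∧ ∀ i, w i m = e i}

/-- The possible endpoints `e` of stars of length `m`, up to the condition `e i ≤ m + 2 i`. -/
def IsEndpoint {p : ℕ} (m : ℕ) (e : Fin p → ℤ) : Prop :=
  (∀ i, 0 ≤ e i) ∧ (∀ i j, i < j → e i < e j) ∧ ∀ i, (e i - m) % 2 = 0

/-- Undo a last step of a star, upwards for the branches in `s` and downwards for the others. -/
def stepBack {p : ℕ} (e : Fin p → ℤ) (s : Finset (Fin p)) (i : Fin p) : ℤ :=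
  if i ∈ s then e i - 1 else e i + 1

open Classical in
/-- Removing the last step of a star. -/
noncomputable def starSuccEquiv {p m : ℕ} {e : Fin p → ℤ} (h0 : ∀ i, 0 ≤ e i)
    (hlt : ∀ i j, i < j → e i < e j) :
    StarTo p (m + 1) e ≃ Σ s : Finset (Fin p), StarTo p m (stepBack e s) where
  toFun w := ⟨Finset.univ.filter fun i => w.1 i m = e i - 1,
    fun i k => if k ≤ m then w.1 i k else 0, by
      obtain ⟨w, ⟨h1, h2, h3, h4, h5⟩, h6⟩ := w
      refine ⟨⟨fun i => by simpa using h1 i, fun i k hk => ?_, fun i k hk => ?_,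
        fun i j hij k hk => ?_, fun i k hk => ?_⟩, fun i => ?_⟩
      · simpa [hk.le, Nat.succ_le_of_lt hk] using h2 i k (by omega)
      · simpa [hk] using h3 i k (by omega)
      · simpa [hk] using h4 i j hij k (by omega)
      · simp [hk]
      · have := h2 i m (by omega)
        have := h6 i
        simp only [le_refl, if_true, stepBack, Finset.mem_filter, Finset.mem_univ, true_and]
        split_ifs <;> omega⟩
  invFun w := ⟨fun i k => if k ≤ m then w.2.1 i k else if k = m + 1 then e i else 0, by
      obtain ⟨s, w, ⟨h1, h2, h3, h4, h5⟩, h6⟩ := w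
      refine ⟨⟨fun i => by simpa using h1 i, fun i k hk => ?_, fun i k hk => ?_,
        fun i j hij k hk => ?_, fun i k hk => ?_⟩, fun i => by simp⟩
      · rcases Nat.lt_succ_iff_lt_or_eq.1 hk with hk | rfl
        · simpa [hk.le, Nat.succ_le_of_lt hk] using h2 i k hk
        · have := h6 i
          simp only [stepBack] at this
          simp only [le_refl, if_true, Nat.not_succ_le_self, if_false]
          split_ifs at this <;> omega
      · rcases Nat.le_succ_iff.1 hk with hk | rfl
        · simpa [hk] using h3 i k hk
        · simpa using h0 i
      · rcases Nat.le_succ_iff.1 hk with hk | rfl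
        · simpa [hk] using h4 i j hij k hk
        · simpa using hlt i j hij
      · have h1 : ¬ k ≤ m := by omega
        have h2 : k ≠ m + 1 := by omega
        simp [h1, h2]⟩
  left_inv := by
    rintro ⟨w, ⟨h1, h2, h3, h4, h5⟩, h6⟩
    ext i k
    by_cases hk : k ≤ m
    · simp [hk]
    · by_cases hk' : k = m + 1
      · subst hk'; simp [h6]
      · simp [hk, hk', h5 i k (by omega)]
  right_inv := by
    rintro ⟨s, w, ⟨h1, h2, h3, h4, h5⟩, h6⟩
    have hs : (Finset.univ.filter fun i => w i m = e i - 1) = s := by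
      ext i
      have := h6 i
      simp only [stepBack] at this
      simp only [Finset.mem_filter, Finset.mem_univ, true_and]
      split_ifs at this with h
      · simp [h, this]
      · simp only [h, iff_false]; omega
    apply Sigma.subtype_ext
    · simpa using hs
    · ext i k
      by_cases hk : k ≤ m
      · simp [hk]
      · simp [hk, h5 i k (by omega)]

theorem isEndpoint_of_star {p m : ℕ} {e : Fin p → ℤ} (w : StarTo p m e) :
    (∀ i, 0 ≤ e i) ∧ ∀ i j, i < j → e i < e j := by
  obtain ⟨w, ⟨h1, h2, h3, h4, h5⟩, h6⟩ := w
  refine ⟨fun i => ?_, fun i j hij => ?_⟩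
  · rw [← h6]; exact h3 i m le_rfl
  · rw [← h6, ← h6]; exact h4 i j hij m le_rfl

instance finite_starTo (p m : ℕ) (e : Fin p → ℤ) : Finite (StarTo p m e) := by
  induction m generalizing e with
  | zero =>
    refine @Finite.of_subsingleton _ ⟨fun w w' => ?_⟩
    obtain ⟨w, ⟨h1, -, -, -, h5⟩, -⟩ := w
    obtain ⟨w', ⟨h1', -, -, -, h5'⟩, -⟩ := w'
    ext i k
    rcases Nat.eq_zero_or_pos k with rfl | hk
    · simp [h1, h1']
    · simp [h5 i k hk, h5' i k hk]
  | succ m ih =>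
    by_cases h : Nonempty (StarTo p (m + 1) e)
    · obtain ⟨h0, hlt⟩ := isEndpoint_of_star h.some
      exact Finite.of_equiv _ (starSuccEquiv h0 hlt).symm
    · rw [not_nonempty_iff] at h
      infer_instance

/-- The number of nonnegative paths of length `m` from `0` to `e`. -/
noncomputable def ballot : ℕ → ℤ → ℝ
  | 0, e => if e = 0 then 1 else 0
  | m + 1, e => if e < 0 then 0 else ballot m (e - 1) + ballot m (e + 1)

theorem ballot_of_neg {m : ℕ} {e : ℤ} (he : e < 0) : ballot m e = 0 := by
  cases m with
  | zero => simp [ballot, he.ne]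
  | succ m => simp [ballot, he]

theorem ballot_succ {m : ℕ} {e : ℤ} (he : 0 ≤ e) :
    ballot (m + 1) e = ballot m (e - 1) + ballot m (e + 1) := by
  simp [ballot, not_lt.2 he]

theorem ballot_of_lt {m : ℕ} {e : ℤ} (he : (m : ℤ) < e) : ballot m e = 0 := by
  induction m generalizing e with
  | zero => simp only [ballot]; rw [if_neg]; simp at he; omega
  | succ m ih =>
    push_cast at he
    rw [ballot_succ (by omega), ih (by omega), ih (by omega), add_zero]

theorem ballot_self (m : ℕ) : ballot m m = 1 := by
  induction m with
  | zero => simp [ballot]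
  | succ m ih =>
    rw [ballot_succ (by omega), ballot_of_lt (e := _ + 1) (by push_cast; omega)]
    simpa using ih

theorem ballot_eq {k l : ℕ} (h : l ≤ k + 1) :
    ballot (k + l) ((k : ℤ) - l) =
      ((k : ℝ) - l + 1) * (k + l).factorial / ((k + 1).factorial * l.factorial) := by
  induction hm : k + l generalizing k l with
  | zero =>
    obtain ⟨rfl, rfl⟩ : k = 0 ∧ l = 0 := by omega
    simp [ballot]
  | succ m ih =>
    rcases h.eq_or_lt with rfl | h
    · rw [ballot_of_neg (by push_cast; omega)]; simp
    rw [ballot_succ (by omega)]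
    rcases Nat.eq_zero_or_pos l with rfl | hl
    · obtain rfl : k = m + 1 := by omega
      have := @ih m 0 (by omega) (by omega)
      rw [ballot_of_lt (e := _ + 1) (by push_cast; omega)]
      simp only [Nat.cast_zero, sub_zero] at this ⊢
      push_cast
      rw [add_sub_cancel_right, this]
      simp [Nat.factorial_succ]
      have := Nat.factorial_ne_zero m
      field_simp
    · obtain ⟨l, rfl⟩ : ∃ l', l = l' + 1 := ⟨l - 1, by omega⟩
      rcases Nat.eq_zero_or_pos k with rfl | hk
      · omega
      obtain ⟨k, rfl⟩ : ∃ k', k = k' + 1 := ⟨k - 1, by omega⟩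
      have h1 := @ih k (l + 1) (by omega) (by omega)
      have h2 := @ih (k + 1) l (by omega) (by omega)
      rw [show ((k + 1 : ℕ) : ℤ) - (l + 1 : ℕ) - 1 = (k : ℤ) - (l + 1 : ℕ) by push_cast; ring,
        show ((k + 1 : ℕ) : ℤ) - (l + 1 : ℕ) + 1 = ((k + 1 : ℕ) : ℤ) - l by push_cast; ring,
        h1, h2]
      have hm' : (m : ℝ) = k + l + 1 := by
        have : m = k + l + 1 := by omega
        exact_mod_cast this
      simp only [Nat.factorial_succ]
      push_cast
      have a1 := Nat.factorial_ne_zero k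
      have a2 := Nat.factorial_ne_zero l
      have a3 := Nat.factorial_ne_zero m
      field_simp
      rw [hm']
      ring

/-- Lindström–Gessel–Viennot for stars with wall condition. -/
theorem card_starTo_eq_det {p m : ℕ} {e : Fin p → ℤ} (he : IsEndpoint m e) :
    (Nat.card (StarTo p m e) : ℝ) =
      (Matrix.of fun i j : Fin p => ballot (m + 2 * j) (e i)).det := by
  induction m generalizing e with
  | zero =>
    obtain ⟨h0, hlt, hpar⟩ := he
    have hge : ∀ i : Fin p, 2 * ((i : ℕ) : ℤ) ≤ e i := by
      rintro ⟨i, hi⟩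
      induction i with
      | zero => simpa using h0 _
      | succ i ih =>
        have h1 := ih (by omega)
        have h2 := hlt ⟨i, by omega⟩ ⟨i + 1, hi⟩ (by simp)
        have h3 := hpar ⟨i, by omega⟩
        have h4 := hpar ⟨i + 1, hi⟩
        push_cast at *
        omega
    rw [Matrix.det_of_isUpperTriangular]
    · simp only [Matrix.of_apply, zero_add]
      by_cases h : ∀ i : Fin p, e i = 2 * ((i : ℕ) : ℤ)
      · have : Unique (StarTo p 0 e) :=
          { default := ⟨fun i k => if k = 0 then e i else 0, by
              refine ⟨⟨fun i => by simp [h], fun i k hk => by omega, fun i k hk => ?_,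
                fun i j hij k hk => ?_, fun i k hk => ?_⟩, by simp⟩
              · simpa [Nat.le_zero.1 hk] using h0 i
              · simpa [Nat.le_zero.1 hk] using hlt i j hij
              · simp [hk.ne']⟩
            uniq := by
              rintro ⟨w, ⟨h1, -, -, -, h5⟩, h6⟩
              ext i k
              rcases Nat.eq_zero_or_pos k with rfl | hk
              · simp [h6]
              · simp [h5 i k hk, hk.ne'] }
        rw [Nat.card_unique, Finset.prod_eq_one]
        · simp
        · intro i _
          rw [h i]
          exact_mod_cast ballot_self (2 * i)
      · have : IsEmpty (StarTo p 0 e) := by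
          refine ⟨fun ⟨w, ⟨h1, _⟩, h6⟩ => h fun i => ?_⟩
          rw [← h6, h1]
        rw [Nat.card_of_isEmpty]
        push Not at h
        obtain ⟨i, hi⟩ := h
        rw [Finset.prod_eq_zero (Finset.mem_univ i), Nat.cast_zero]
        apply ballot_of_lt
        have := hge i
        push_cast
        omega
    · intro i j hij
      simp only [Matrix.of_apply, zero_add]
      apply ballot_of_lt
      have := hge i
      have : (j : ℕ) < i := hij
      push_cast
      omega
  | succ m ih =>
    obtain ⟨h0, hlt, hpar⟩ := he
    have key : (Matrix.of fun i j : Fin p => ballot (m + 1 + 2 * j) (e i)).det =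
        ∑ s : Finset (Fin p),
          (Matrix.of fun i j : Fin p => ballot (m + 2 * j) (stepBack e s i)).det := by
      have := (Matrix.detRowAlternating (n := Fin p) (R := ℝ)).toMultilinearMap.map_add_univ
        (fun i j => ballot (m + 2 * j) (e i - 1)) (fun i j => ballot (m + 2 * j) (e i + 1))
      convert this using 1
      · congr 1
        ext i j
        rw [Matrix.of_apply, show m + 1 + 2 * (j : ℕ) = m + 2 * j + 1 by ring, ballot_succ (h0 i)]
        rfl
      · refine Finset.sum_congr rfl fun s _ => ?_
        congr 1
        ext i j
        simp only [Matrix.of_apply, stepBack, Finset.piecewise]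
        split_ifs <;> rfl
    rw [key, Nat.card_congr (starSuccEquiv h0 hlt), Nat.card_sigma, Nat.cast_sum]
    refine Finset.sum_congr rfl fun s _ => ?_
    have hpar' : ∀ i, (stepBack e s i - m) % 2 = 0 := by
      intro i
      have := hpar i
      push_cast at this
      simp only [stepBack]
      split_ifs <;> omega
    by_cases hc : (∀ i, 0 ≤ stepBack e s i) ∧ ∀ i j, i < j → stepBack e s i < stepBack e s j
    · exact ih ⟨hc.1, hc.2, hpar'⟩
    · have : IsEmpty (StarTo p m (stepBack e s)) := ⟨fun w => hc (isEndpoint_of_star w)⟩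
      rw [Nat.card_of_isEmpty, Nat.cast_zero, eq_comm]
      rw [not_and_or] at hc
      push Not at hc
      rcases hc with ⟨i, hi⟩ | ⟨i, j, hij, hle⟩
      · apply Matrix.det_eq_zero_of_row_eq_zero i
        intro j
        exact ballot_of_neg hi
      · apply Matrix.det_zero_of_row_eq hij.ne
        have heq : stepBack e s i = stepBack e s j := by
          have := hpar i
          have := hpar j
          have := hlt i j hij
          simp only [stepBack] at *
          split_ifs at * <;> omega
        ext k
        simp [heq]

theorem factorial_add_eq_mul_prod (k : ℕ) {a b : ℕ} (hab : a ≤ b) :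
    (k + b).factorial = (k + a).factorial * ∏ i ∈ Finset.Ico a b, (k + i + 1) := by
  induction b, hab using Nat.le_induction with
  | base => simp
  | succ b hb ih =>
    rw [Finset.prod_Ico_succ_top hb, ← add_assoc, Nat.factorial_succ, ih]
    ring

theorem ballot_eq_mul_prod {p m k l j : ℕ} {e : ℤ} (hkl : k + l = m) (he : (k : ℤ) - l = e)
    (he0 : 0 ≤ e) (hj : j < p) :
    ballot (m + 2 * j) e =
      ((e : ℝ) + 1) / ((k + p).factorial * (l + (p - 1)).factorial) * ((m + 2 * j).factorial *
        ∏ i ∈ Finset.Ico (j + 1) p, ((((m : ℝ) + 1) / 2 + i) ^ 2 - (((e : ℝ) + 1) / 2) ^ 2)) := by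
  have h := @ballot_eq (k + j) (l + j) (by omega)
  rw [show k + j + (l + j) = m + 2 * j by omega,
    show ((k + j : ℕ) : ℤ) - (l + j : ℕ) = e by push_cast; omega] at h
  have h1 : ((k + p).factorial : ℝ) =
      (k + j + 1).factorial * ∏ i ∈ Finset.Ico (j + 1) p, ((k : ℝ) + i + 1) := by
    exact_mod_cast factorial_add_eq_mul_prod k (Nat.succ_le_of_lt hj)
  have h2 : ((l + (p - 1)).factorial : ℝ) =
      (l + j).factorial * ∏ i ∈ Finset.Ico (j + 1) p, ((l : ℝ) + i) := by
    obtain ⟨q, rfl⟩ : ∃ q, p = q + 1 := ⟨p - 1, by omega⟩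
    rw [Nat.add_sub_cancel, ← Finset.prod_Ico_add' (fun i : ℕ => (l : ℝ) + i) j q 1]
    have := factorial_add_eq_mul_prod l (Nat.le_of_lt_succ hj)
    rw [this]
    push_cast
    simp only [add_assoc]
  have hm : (m : ℝ) = k + l := by exact_mod_cast hkl.symm
  have he' : (e : ℝ) = k - l := by rw [← he]; push_cast; ring
  have h3 : ∏ i ∈ Finset.Ico (j + 1) p, ((((m : ℝ) + 1) / 2 + i) ^ 2 - (((e : ℝ) + 1) / 2) ^ 2) =
      (∏ i ∈ Finset.Ico (j + 1) p, ((k : ℝ) + i + 1)) *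
        ∏ i ∈ Finset.Ico (j + 1) p, ((l : ℝ) + i) := by
    rw [← Finset.prod_mul_distrib]
    refine Finset.prod_congr rfl fun i _ => ?_
    rw [hm, he']
    ring
  have h4 : (∏ i ∈ Finset.Ico (j + 1) p, ((k : ℝ) + i + 1)) ≠ 0 :=
    Finset.prod_ne_zero_iff.2 fun i _ => by positivity
  have h5 : (∏ i ∈ Finset.Ico (j + 1) p, ((l : ℝ) + i)) ≠ 0 :=
    Finset.prod_ne_zero_iff.2 fun i hi => by
      have : 0 < i := by have := (Finset.mem_Ico.1 hi).1; omega
      positivity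
  rw [h, h1, h2, h3, he']
  have a1 := Nat.factorial_ne_zero (k + j + 1)
  have a2 := Nat.factorial_ne_zero (l + j)
  push_cast
  field_simp
  ring

theorem det_prod_sub_sq {p : ℕ} (c : ℕ → ℝ) (y : Fin p → ℝ) :
    (Matrix.of fun i j : Fin p => ∏ k ∈ Finset.Ico (j + 1 : ℕ) p, (c k - y i)).det =
      ∏ i, ∏ j ∈ Finset.Ioi i, (y j - y i) := by
  have h := Matrix.det_eval_matrixOfPolynomials_eq_det_vandermonde (fun i : Fin p => - y i.rev)
    (fun j => ∏ k ∈ Finset.Ico (p - j : ℕ) p, (Polynomial.X + Polynomial.C (c k)))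
    (fun j => by
      rw [Polynomial.natDegree_prod_of_monic _ _ fun k _ => Polynomial.monic_X_add_C _]
      simp
      omega)
    (fun j => Polynomial.monic_prod_of_monic _ _ fun k _ => Polynomial.monic_X_add_C _)
  rw [← Matrix.det_submatrix_equiv_self Fin.revPerm]
  rw [Matrix.det_vandermonde] at h
  convert h.symm using 1
  · congr 1
    ext i j
    simp only [Matrix.submatrix_apply, Matrix.of_apply, Fin.revPerm_apply, Polynomial.eval_prod,
      Polynomial.eval_add, Polynomial.eval_X, Polynomial.eval_C, Fin.val_rev]
    rw [show p - (j + 1 : ℕ) + 1 = p - j by omega]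
    exact Finset.prod_congr rfl fun k _ => by ring
  · rw [Finset.prod_sigma', Finset.prod_sigma']
    refine Finset.prod_bij' (fun a _ => ⟨a.2.rev, a.1.rev⟩) (fun a _ => ⟨a.2.rev, a.1.rev⟩)
      ?_ ?_ ?_ ?_ ?_ <;> simp
    intro a _
    ring

/-- The product formula for the number of stars with wall condition and prescribed endpoints. -/
theorem card_starTo {p m : ℕ} {e : Fin p → ℤ} (h : IsEndpoint m e) (k l : Fin p → ℕ)
    (hkl : ∀ i, k i + l i = m) (he : ∀ i, (k i : ℤ) - l i = e i) :
    (Nat.card (StarTo p m e) : ℝ) =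
      (∏ i : Fin p, (((e i : ℝ) + 1) * ((m + 2 * (i : ℕ)).factorial /
          ((k i + p).factorial * (l i + (p - 1)).factorial)))) *
        ∏ i : Fin p, ∏ j ∈ Finset.Ioi i, (((e j : ℝ) - e i) * (e i + e j + 2) / 4) := by
  have h1 : (Matrix.of fun i j : Fin p => ballot (m + 2 * j) (e i)) =
      Matrix.of fun i j : Fin p =>
        (((e i : ℝ) + 1) / ((k i + p).factorial * (l i + (p - 1)).factorial)) *
          (Matrix.of fun i j : Fin p => ((m + 2 * (j : ℕ)).factorial : ℝ) *
            (Matrix.of fun i j : Fin p => ∏ q ∈ Finset.Ico (j + 1 : ℕ) p,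
              ((((m : ℝ) + 1) / 2 + q) ^ 2 - (((e i : ℝ) + 1) / 2) ^ 2)) i j) i j := by
    ext i j
    exact ballot_eq_mul_prod (hkl i) (he i) (h.1 i) j.2
  rw [card_starTo_eq_det h, h1, Matrix.det_mul_column, Matrix.det_mul_row,
    det_prod_sub_sq (fun q => (((m : ℝ) + 1) / 2 + q) ^ 2) (fun i => (((e i : ℝ) + 1) / 2) ^ 2),
    ← mul_assoc, ← Finset.prod_mul_distrib]
  congr 1
  · exact Finset.prod_congr rfl fun i _ => by ring
  · exact Finset.prod_congr rfl fun i _ => Finset.prod_congr rfl fun j _ => by ring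

/-- Cutting a watermelon at time `m` into two stars. -/
def melonEquiv {p n m : ℕ} (hm : m ≤ 2 * n) (e : Fin p → ℤ) :
    {w : Fin p → ℕ → ℤ // IsMelonW p n w ∧ ∀ i, w i m = e i} ≃
      StarTo p m e × StarTo p (2 * n - m) e where
  toFun w := (⟨fun i k => if k ≤ m then w.1 i k else 0, by
      obtain ⟨w, ⟨⟨h1, h2, h3, h4, h5⟩, h6⟩, h7⟩ := w
      refine ⟨⟨fun i => by simpa using h1 i, fun i k hk => ?_, fun i k hk => ?_,
        fun i j hij k hk => ?_, fun i k hk => ?_⟩, fun i => ?_⟩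
      · simpa [hk.le, Nat.succ_le_of_lt hk] using h2 i k (by omega)
      · simpa [hk] using h3 i k (by omega)
      · simpa [hk] using h4 i j hij k (by omega)
      · simp [hk]
      · simpa using h7 i⟩,
    ⟨fun i k => if k ≤ 2 * n - m then w.1 i (2 * n - k) else 0, by
      obtain ⟨w, ⟨⟨h1, h2, h3, h4, h5⟩, h6⟩, h7⟩ := w
      refine ⟨⟨fun i => by simpa using h6 i, fun i k hk => ?_, fun i k hk => ?_,
        fun i j hij k hk => ?_, fun i k hk => ?_⟩, fun i => ?_⟩
      · have := h2 i (2 * n - (k + 1)) (by omega)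
        rw [show 2 * n - (k + 1) + 1 = 2 * n - k by omega] at this
        simp only [hk.le, Nat.succ_le_of_lt hk, if_true]
        omega
      · simpa [hk] using h3 i _ (by omega)
      · simpa [hk] using h4 i j hij _ (by omega)
      · simp [hk]
      · simpa [Nat.sub_sub_self hm] using h7 i⟩)
  invFun w := ⟨fun i k => if k ≤ m then w.1.1 i k else if k ≤ 2 * n then w.2.1 i (2 * n - k)
      else 0, by
    obtain ⟨⟨u, ⟨h1, h2, h3, h4, h5⟩, h6⟩, ⟨v, ⟨h1', h2', h3', h4', h5'⟩, h6'⟩⟩ := w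
    refine ⟨⟨⟨fun i => by simpa using h1 i, fun i k hk => ?_, fun i k hk => ?_,
        fun i j hij k hk => ?_, fun i k hk => ?_⟩, fun i => ?_⟩, fun i => by simpa using h6 i⟩
    · rcases lt_trichotomy k m with hkm | rfl | hkm
      · simpa [hkm.le, Nat.succ_le_of_lt hkm] using h2 i k hkm
      · have := h2' i (2 * n - (k + 1)) (by omega)
        rw [show 2 * n - (k + 1) + 1 = 2 * n - k by omega, h6' i] at this
        have := h6 i
        simp only [le_refl, if_true, Nat.not_succ_le_self, if_false, Nat.succ_le_of_lt hk]
        omega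
      · have := h2' i (2 * n - (k + 1)) (by omega)
        rw [show 2 * n - (k + 1) + 1 = 2 * n - k by omega] at this
        have a1 : ¬ k ≤ m := by omega
        have a2 : ¬ k + 1 ≤ m := by omega
        simp only [a1, a2, if_false, hk.le, if_true, Nat.succ_le_of_lt hk]
        omega
    · by_cases hkm : k ≤ m
      · simpa [hkm] using h3 i k hkm
      · simpa [hkm, hk] using h3' i (2 * n - k) (by omega)
    · by_cases hkm : k ≤ m
      · simpa [hkm] using h4 i j hij k hkm
      · simpa [hkm, hk] using h4' i j hij (2 * n - k) (by omega)
    · have a1 : ¬ k ≤ m := by omega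
      have a2 : ¬ k ≤ 2 * n := by omega
      simp [a1, a2]
    · by_cases hkm : 2 * n ≤ m
      · obtain rfl : m = 2 * n := by omega
        have := h6 i
        have := h6' i
        have := h1' i
        simp only [Nat.sub_self] at *
        simp only [le_refl, if_true]
        omega
      · simpa [hkm] using h1' i⟩
  left_inv := by
    rintro ⟨w, ⟨⟨h1, h2, h3, h4, h5⟩, h6⟩, h7⟩
    ext i k
    by_cases hk : k ≤ m
    · simp [hk]
    · by_cases hk' : k ≤ 2 * n
      · have a1 : 2 * n - k ≤ 2 * n - m := by omega
        simp only [hk, hk', if_true, if_false, a1, Nat.sub_sub_self hk']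
      · simp [hk, hk', h5 i k (by omega)]
  right_inv := by
    rintro ⟨⟨u, ⟨h1, h2, h3, h4, h5⟩, h6⟩, ⟨v, ⟨h1', h2', h3', h4', h5'⟩, h6'⟩⟩
    ext i k
    · by_cases hk : k ≤ m
      · simp [hk]
      · simp [hk, h5 i k (by omega)]
    · by_cases hk : k ≤ 2 * n - m
      · rcases hk.eq_or_lt with rfl | hk'
        · simp only [le_refl, if_true, Nat.sub_sub_self hm, h6, h6']
        · have a1 : ¬ 2 * n - k ≤ m := by omega
          have a2 : 2 * n - (2 * n - k) = k := by omega
          simp [hk, a1, a2]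
      · simp [hk, h5' i k (by omega)]

theorem probW_eq {p n m : ℕ} (hm : m ≤ 2 * n) (e : Fin p → ℤ) :
    probW p n (fun w => ∀ i, w i m = e i) =
      Nat.card (StarTo p m e) * Nat.card (StarTo p (2 * n - m) e) /
        Nat.card (StarTo p (2 * n) fun i => 2 * ((i : ℕ) : ℤ)) := by
  rw [probW, Nat.card_congr (melonEquiv hm e), Nat.card_prod, Nat.cast_mul]
  rfl

open Asymptotics Topology

/-- `f` and `g` agree along `l` up to a factor `exp (O(r))`. -/
def RelEq {α : Type*} (l : Filter α) (r f g : α → ℝ) : Prop :=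
  ∃ h : α → ℝ, h =O[l] r ∧ f =ᶠ[l] fun a => g a * Real.exp (h a)

namespace RelEq

variable {α : Type*} {l : Filter α} {r f g f' g' : α → ℝ}

theorem of_eventuallyEq (h : f =ᶠ[l] g) : RelEq l r f g :=
  ⟨0, isBigO_zero _ _, h.trans (by simp)⟩

theorem trans (h : RelEq l r f g) (h' : RelEq l r g f') : RelEq l r f f' := by
  obtain ⟨u, hu, hfg⟩ := h
  obtain ⟨v, hv, hgf⟩ := h'
  refine ⟨u + v, hu.add hv, ?_⟩
  filter_upwards [hfg, hgf] with a h1 h2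
  rw [h1, h2, Pi.add_apply, Real.exp_add]
  ring

theorem mul (h : RelEq l r f g) (h' : RelEq l r f' g') :
    RelEq l r (fun a => f a * f' a) fun a => g a * g' a := by
  obtain ⟨u, hu, hfg⟩ := h
  obtain ⟨v, hv, hgf⟩ := h'
  refine ⟨u + v, hu.add hv, ?_⟩
  filter_upwards [hfg, hgf] with a h1 h2
  rw [h1, h2, Pi.add_apply, Real.exp_add]
  ring

theorem mul_left (c : α → ℝ) (h : RelEq l r f g) :
    RelEq l r (fun a => c a * f a) fun a => c a * g a :=
  (of_eventuallyEq .rfl).mul h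

theorem inv (h : RelEq l r f g) : RelEq l r (fun a => (f a)⁻¹) fun a => (g a)⁻¹ := by
  obtain ⟨u, hu, hfg⟩ := h
  refine ⟨fun a => -u a, hu.neg_left, ?_⟩
  filter_upwards [hfg] with a h1
  rw [h1, mul_inv, Real.exp_neg]

theorem div (h : RelEq l r f g) (h' : RelEq l r f' g') :
    RelEq l r (fun a => f a / f' a) fun a => g a / g' a := by
  simpa only [div_eq_mul_inv] using h.mul h'.inv

theorem sqrt (h : RelEq l r f g) : RelEq l r (fun a => √(f a)) fun a => √(g a) := by
  obtain ⟨u, hu, hfg⟩ := h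
  refine ⟨fun a => u a / 2, by simpa only [div_eq_inv_mul] using hu.const_mul_left _, ?_⟩
  filter_upwards [hfg] with a h1
  rw [h1, Real.sqrt_mul' _ (Real.exp_pos _).le, Real.exp_half]

theorem prod {ι : Type*} (t : Finset ι) {f g : ι → α → ℝ} (h : ∀ i ∈ t, RelEq l r (f i) (g i)) :
    RelEq l r (fun a => ∏ i ∈ t, f i a) fun a => ∏ i ∈ t, g i a := by
  classical
  induction t using Finset.induction_on with
  | empty => exact of_eventuallyEq (by simp)
  | insert i t hi ih =>
    simp only [Finset.prod_insert hi]
    exact (h i (by simp)).mul (ih fun j hj => h j (by simp [hj]))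

theorem exp (h : (fun a => f a - g a) =O[l] r) :
    RelEq l r (fun a => Real.exp (f a)) fun a => Real.exp (g a) :=
  ⟨_, h, .of_forall fun a => by simp only [← Real.exp_add]; ring_nf⟩

theorem of_div_sub_one (hr : Tendsto r l (𝓝 0)) (hg : ∀ᶠ a in l, g a ≠ 0)
    (h : (fun a => f a / g a - 1) =O[l] r) : RelEq l r f g := by
  have hsmall : ∀ᶠ a in l, |f a / g a - 1| < 1 / 2 := by
    have := (h.trans_tendsto hr).abs
    rw [abs_zero] at this
    exact this.eventually_lt_const (by norm_num)
  refine ⟨fun a => Real.log (f a / g a), IsBigO.trans (IsBigO.of_bound 2 ?_) h, ?_⟩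
  · filter_upwards [hsmall] with a ha
    have h1 := Real.abs_log_sub_add_sum_range_le (x := 1 - f a / g a)
      (by rw [abs_sub_comm]; linarith) 0
    simp only [Finset.range_zero, Finset.sum_empty, zero_add, sub_sub_cancel, pow_one,
      abs_sub_comm (1 : ℝ)] at h1
    rw [Real.norm_eq_abs, Real.norm_eq_abs]
    refine h1.trans ?_
    rw [div_le_iff₀ (by linarith)]
    nlinarith [abs_nonneg (f a / g a - 1)]
  · filter_upwards [hsmall, hg] with a ha hga
    rw [Real.exp_log (by linarith [(abs_lt.1 ha).1]), mul_div_cancel₀ _ hga]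

theorem isBigO_div_sub_one (hr : Tendsto r l (𝓝 0)) (hg : ∀ᶠ a in l, g a ≠ 0)
    (h : RelEq l r f g) : (fun a => f a / g a - 1) =O[l] r := by
  obtain ⟨u, hu, hfg⟩ := h
  refine IsBigO.trans (IsBigO.of_bound 2 ?_) hu
  have hsmall : ∀ᶠ a in l, |u a| < 1 := by
    have := (hu.trans_tendsto hr).abs
    rw [abs_zero] at this
    exact this.eventually_lt_const (by norm_num)
  filter_upwards [hfg, hsmall, hg] with a h1 h2 h3
  rw [h1, mul_div_cancel_left₀ _ h3, Real.norm_eq_abs, Real.norm_eq_abs]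
  exact Real.abs_exp_sub_one_le h2.le

/-- A perturbation of order `s` of a multiple of `s ^ 2`. -/
theorem of_sub_isBigO {s : α → ℝ} (hs : Tendsto s l atTop) {c : ℝ} (hc : 0 < c)
    (h : (fun a => f a - c * s a ^ 2) =O[l] s) :
    RelEq l (fun a => (s a)⁻¹) f fun a => c * s a ^ 2 := by
  refine of_div_sub_one hs.inv_tendsto_atTop ?_ ?_
  · filter_upwards [hs.eventually_gt_atTop 0] with a ha
    positivity
  · have h1 := h.mul (isBigO_refl (fun a => (c * s a ^ 2)⁻¹) l)
    refine (h1.congr' ?_ ?_).trans (isBigO_const_mul_self c⁻¹ _ l)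
    · filter_upwards [hs.eventually_gt_atTop 0] with a ha
      field_simp
    · filter_upwards [hs.eventually_gt_atTop 0] with a ha
      field_simp

end RelEq

theorem log_stirlingSeq_le {n : ℕ} (hn : n ≠ 0) :
    Real.log (Stirling.stirlingSeq n) ≤ Real.log √Real.pi + 1 / n := by
  have hmono : Monotone fun q : ℕ =>
      Real.log (Stirling.stirlingSeq (q + 1)) - 1 / ((q + 1 : ℕ) : ℝ) := by
    refine monotone_nat_of_le_succ fun q => ?_
    have h1 := Stirling.log_stirlingSeq_sdiff_le (q + 1)
    have h2 : (1 : ℝ) / (12 * ((q + 1 : ℕ) : ℝ) * (((q + 1 : ℕ) : ℝ) + 1)) ≤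
        1 / ((q + 1 : ℕ) : ℝ) - 1 / ((q + 1 + 1 : ℕ) : ℝ) := by
      push_cast
      rw [div_sub_div _ _ (by positivity) (by positivity),
        div_le_div_iff₀ (by positivity) (by positivity)]
      have : (0 : ℝ) ≤ q := q.cast_nonneg
      nlinarith [mul_nonneg this this]
    linarith
  have hlim : Tendsto (fun q : ℕ =>
      Real.log (Stirling.stirlingSeq (q + 1)) - 1 / ((q + 1 : ℕ) : ℝ)) atTop
      (𝓝 (Real.log √Real.pi - 0)) := by
    refine Tendsto.sub ?_ ?_
    · exact ((Real.continuousAt_log (by positivity)).tendsto.comp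
        Stirling.tendsto_stirlingSeq_sqrt_pi).comp (tendsto_add_atTop_nat 1)
    · exact (tendsto_one_div_atTop_nhds_zero_nat (𝕜 := ℝ)).comp (tendsto_add_atTop_nat 1)
  obtain ⟨q, rfl⟩ := Nat.exists_eq_succ_of_ne_zero hn
  have := hmono.ge_of_tendsto hlim q
  simp only [sub_zero] at this
  linarith

/-- Stirling's formula with an error term. -/
theorem factorial_eq_stirling_mul_exp {n : ℕ} (hn : n ≠ 0) :
    ∃ h : ℝ, |h| ≤ 1 / n ∧
      (n.factorial : ℝ) = √(2 * Real.pi * n) * (n / Real.exp 1) ^ n * Real.exp h := by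
  have hpos : 0 < Stirling.stirlingSeq n := by
    obtain ⟨q, rfl⟩ := Nat.exists_eq_succ_of_ne_zero hn
    exact Stirling.stirlingSeq'_pos q
  have hpi : 0 < √Real.pi := by positivity
  refine ⟨Real.log (Stirling.stirlingSeq n) - Real.log √Real.pi, ?_, ?_⟩
  · have h1 := log_stirlingSeq_le hn
    have h2 := Real.log_le_log hpi (Stirling.sqrt_pi_le_stirlingSeq hn)
    rw [abs_of_nonneg (by linarith)]
    linarith
  · rw [Real.exp_sub, Real.exp_log hpos, Real.exp_log hpi, Stirling.stirlingSeq]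
    have hn' : (0 : ℝ) < n := by positivity
    rw [show 2 * Real.pi * n = Real.pi * (2 * n) by ring, Real.sqrt_mul Real.pi_pos.le]
    field_simp

theorem abs_entropy_sub_sq_le {u : ℝ} (hu : |u| ≤ 1 / 2) :
    |(1 + u) * Real.log (1 + u) + (1 - u) * Real.log (1 - u) - u ^ 2| ≤ 4 * |u| ^ 3 := by
  have key : ∀ v : ℝ, |v| ≤ 1 / 2 → |v + v ^ 2 / 2 + Real.log (1 - v)| ≤ 2 * |v| ^ 3 := by
    intro v hv
    have := Real.abs_log_sub_add_sum_range_le (x := v) (by linarith) 2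
    simp only [Finset.sum_range_succ, Finset.range_zero, Finset.sum_empty] at this
    norm_num at this
    refine this.trans ?_
    rw [div_le_iff₀ (by linarith)]
    nlinarith [pow_nonneg (abs_nonneg v) 3]
  have h1 := key u hu
  have h2 := key (-u) (by rwa [abs_neg])
  rw [abs_neg, sub_neg_eq_add] at h2
  have hu' := abs_le.1 hu
  rw [abs_le] at h1 h2 ⊢
  constructor <;> nlinarith [pow_nonneg (abs_nonneg u) 3]

theorem abs_log_central_le {k l y s τ C Y : ℝ} (hk : 0 < k) (hl : 0 < l) (hs : 0 < s)
    (hτ : 0 < τ) (hy : |y| ≤ Y) (hkl : k - l = y * s) (hm : |k + l - τ * s ^ 2| ≤ C * s)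
    (hm' : τ / 2 * s ^ 2 ≤ k + l) (hY : 4 * Y ≤ τ * s) :
    |((k + l) * Real.log (k + l) - k * Real.log k - l * Real.log l) -
      ((k + l) * Real.log 2 + -(y ^ 2) / (2 * τ))| ≤
      (8 * Y ^ 3 / τ ^ 2 + C * Y ^ 2 / τ ^ 2) * s⁻¹ := by
  set m := k + l with hmdef
  have hm0 : 0 < m := by positivity
  set u := (k - l) / m with hudef
  have hum : u * m = y * s := by rw [hudef, hkl]; field_simp
  have hY0 : 0 ≤ Y := (abs_nonneg y).trans hy
  have habs : |u| * m = |y| * s := by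
    have := congrArg abs hum
    rwa [abs_mul, abs_mul, abs_of_pos hs, abs_of_pos hm0] at this
  have hu1 : |u| * (τ / 2 * s) ≤ Y := by
    have : |u| * (τ / 2 * s) * s ≤ Y * s := by
      calc |u| * (τ / 2 * s) * s = |u| * (τ / 2 * s ^ 2) := by ring
        _ ≤ |u| * m := by gcongr
        _ ≤ Y * s := by rw [habs]; gcongr
    exact le_of_mul_le_mul_right this hs
  have hu : |u| ≤ 1 / 2 := by
    have : |u| * (τ * s) ≤ 1 / 2 * (τ * s) := by nlinarith
    exact le_of_mul_le_mul_right this (by positivity)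
  have hu' := abs_le.1 hu
  have hk' : k = m / 2 * (1 + u) := by
    rw [hudef]; field_simp; rw [hmdef]; ring
  have hl' : l = m / 2 * (1 - u) := by
    rw [hudef]; field_simp; rw [hmdef]; ring
  have hlogk : Real.log k = Real.log m - Real.log 2 + Real.log (1 + u) := by
    rw [hk', Real.log_mul (by positivity) (by linarith), Real.log_div hm0.ne' two_ne_zero]
  have hlogl : Real.log l = Real.log m - Real.log 2 + Real.log (1 - u) := by
    rw [hl', Real.log_mul (by positivity) (by linarith), Real.log_div hm0.ne' two_ne_zero]
  have hE := abs_entropy_sub_sq_le hu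
  set E := (1 + u) * Real.log (1 + u) + (1 - u) * Real.log (1 - u) with hEdef
  have hrew : (m * Real.log m - k * Real.log k - l * Real.log l) -
      (m * Real.log 2 + -(y ^ 2) / (2 * τ)) =
      -(m / 2 * (E - u ^ 2)) + (y ^ 2 / (2 * τ) - m / 2 * u ^ 2) := by
    rw [hlogk, hlogl, hk', hl', hEdef]
    ring
  rw [hrew, add_mul]
  refine (abs_add_le _ _).trans (add_le_add ?_ ?_)
  · rw [abs_neg, abs_mul, abs_of_pos (by positivity : 0 < m / 2)]
    have h1 : m / 2 * |E - u ^ 2| ≤ m / 2 * (4 * |u| ^ 3) := by gcongr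
    have h2 : m / 2 * (4 * |u| ^ 3) = 2 * (|y| * s) * |u| ^ 2 := by rw [← habs]; ring
    have h3 : |u| ≤ 2 * Y / (τ * s) := by
      rw [le_div_iff₀ (by positivity)]; linarith
    calc m / 2 * |E - u ^ 2| ≤ 2 * (|y| * s) * |u| ^ 2 := h1.trans h2.le
      _ ≤ 2 * (Y * s) * (2 * Y / (τ * s)) ^ 2 := by gcongr
      _ = 8 * Y ^ 3 / τ ^ 2 * s⁻¹ := by field_simp; ring
  · have h1 : y ^ 2 / (2 * τ) - m / 2 * u ^ 2 = y ^ 2 * ((m - τ * s ^ 2) / (2 * τ * m)) := by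
      have : u = y * s / m := by rw [hudef, hkl]
      rw [this]
      field_simp
    rw [h1, abs_mul, abs_pow, abs_div, abs_of_pos (by positivity : 0 < 2 * τ * m)]
    calc |y| ^ 2 * (|m - τ * s ^ 2| / (2 * τ * m))
        ≤ Y ^ 2 * (C * s / (2 * τ * (τ / 2 * s ^ 2))) := by
          have : 0 ≤ C * s := (abs_nonneg _).trans hm
          gcongr
      _ = C * Y ^ 2 / τ ^ 2 * s⁻¹ := by field_simp

section Factorials

variable {α : Type*} {l : Filter α} {s : α → ℝ}

theorem eventually_le_of_sub_isBigO (hs : Tendsto s l atTop) {c : ℝ} (hc : 0 < c) {f : α → ℝ}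
    (h : (fun a => f a - c * s a ^ 2) =O[l] s) : ∀ᶠ a in l, c / 2 * s a ^ 2 ≤ f a := by
  obtain ⟨C, hC⟩ := h.bound
  filter_upwards [hC, hs.eventually_gt_atTop 0, hs.eventually_ge_atTop (2 * C / c)]
    with a h1 h2 h3
  rw [Real.norm_eq_abs, Real.norm_eq_abs, abs_of_pos h2] at h1
  rw [div_le_iff₀ hc] at h3
  nlinarith [(abs_le.1 h1).1]

theorem isBigO_one_of_tendsto_atTop (hs : Tendsto s l atTop) (c : ℝ) :
    (fun _ => c) =O[l] s :=
  (isLittleO_const_left.2 (Or.inr (tendsto_norm_atTop_atTop.comp hs))).isBigO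

theorem relEq_factorial_add (hs : Tendsto s l atTop) {c : ℝ} (hc : 0 < c) {k : α → ℕ}
    (h : (fun a => (k a : ℝ) - c * s a ^ 2) =O[l] s) (q : ℕ) :
    RelEq l (fun a => (s a)⁻¹) (fun a => ((k a + q).factorial : ℝ))
      fun a => (k a).factorial * (c * s a ^ 2) ^ q := by
  induction q with
  | zero => exact .of_eventuallyEq (by simp)
  | succ q ih =>
    have h1 : RelEq l (fun a => (s a)⁻¹) (fun a => (k a : ℝ) + (q + 1)) fun a => c * s a ^ 2 := by
      refine .of_sub_isBigO hs hc ?_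
      refine (h.add (isBigO_one_of_tendsto_atTop hs ((q : ℝ) + 1))).congr_left fun a => ?_
      ring
    refine (RelEq.of_eventuallyEq (.of_forall fun a => ?_)).trans ((h1.mul ih).trans
      (RelEq.of_eventuallyEq (.of_forall fun a => ?_)))
    · simp only [← add_assoc, Nat.factorial_succ]
      push_cast
      ring
    · simp only
      ring

theorem relEq_factorial (hs : Tendsto s l atTop) {c : ℝ} (hc : 0 < c) {k : α → ℕ}
    (h : (fun a => (k a : ℝ) - c * s a ^ 2) =O[l] s) :
    RelEq l (fun a => (s a)⁻¹) (fun a => ((k a).factorial : ℝ))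
      fun a => √(2 * Real.pi * (c * s a ^ 2)) *
        Real.exp (k a * Real.log (k a) - k a) := by
  have hge := eventually_le_of_sub_isBigO hs hc h
  have h1 : RelEq l (fun a => (s a)⁻¹) (fun a => ((k a).factorial : ℝ))
      fun a => √(2 * Real.pi * k a) * Real.exp (k a * Real.log (k a) - k a) := by
    have hex : ∀ a, ∃ u : ℝ, k a ≠ 0 → |u| ≤ 1 / k a ∧ ((k a).factorial : ℝ) =
        √(2 * Real.pi * k a) * (k a / Real.exp 1) ^ (k a) * Real.exp u := fun a => by
      by_cases hk : k a = 0
      · exact ⟨0, fun h => absurd hk h⟩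
      · obtain ⟨u, hu⟩ := factorial_eq_stirling_mul_exp hk
        exact ⟨u, fun _ => hu⟩
    choose u hu using hex
    have hpos : ∀ᶠ a in l, 0 < (k a : ℝ) := by
      filter_upwards [hge, hs.eventually_gt_atTop 0] with a h2 h3
      exact lt_of_lt_of_le (by positivity) h2
    refine ⟨u, IsBigO.of_bound (2 / c) ?_, ?_⟩
    · filter_upwards [hge, hpos, hs.eventually_ge_atTop 1] with a h2 h3 h4
      have h5 := (hu a (by exact_mod_cast h3.ne')).1
      rw [Real.norm_eq_abs, norm_inv, Real.norm_of_nonneg (zero_le_one.trans h4)]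
      refine h5.trans ?_
      rw [div_mul_eq_mul_div, ← div_eq_mul_inv, div_div, div_le_div_iff₀ h3 (by positivity)]
      nlinarith
    · filter_upwards [hpos] with a h3
      rw [(hu a (by exact_mod_cast h3.ne')).2, div_pow, ← Real.exp_nat_mul, mul_one, Real.exp_sub,
        mul_comm (k a : ℝ) (Real.log _), Real.exp_mul, Real.exp_log h3, Real.rpow_natCast]
  refine h1.trans (RelEq.mul (RelEq.sqrt ?_) (.of_eventuallyEq .rfl))
  exact (RelEq.of_sub_isBigO hs hc h).mul_left _

/-- A uniform local central limit theorem for quotients of factorials. -/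
theorem relEq_factorial_div (hs : Tendsto s l atTop) {τ : ℝ} (hτ : 0 < τ) {m k k' : α → ℕ}
    {y : α → ℝ} (hkm : ∀ᶠ a in l, k a + k' a = m a)
    (hm : (fun a => (m a : ℝ) - τ * s a ^ 2) =O[l] s) (hy : y =O[l] fun _ => (1 : ℝ))
    (hky : ∀ᶠ a in l, (k a : ℝ) - k' a = y a * s a) (q p p' : ℕ) :
    RelEq l (fun a => (s a)⁻¹)
      (fun a => ((m a + q).factorial : ℝ) / ((k a + p).factorial * (k' a + p').factorial))
      fun a => 2 ^ m a * (√(2 / (Real.pi * (τ * s a ^ 2))) * Real.exp (-(y a ^ 2) / (2 * τ)) *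
        ((τ * s a ^ 2) ^ q / ((τ / 2 * s a ^ 2) ^ p * (τ / 2 * s a ^ 2) ^ p'))) := by
  have hys : (fun a => y a * s a) =O[l] s := by
    simpa using hy.mul (isBigO_refl s l)
  have hk : (fun a => (k a : ℝ) - τ / 2 * s a ^ 2) =O[l] s := by
    refine ((hm.add hys).const_mul_left (1 / 2)).congr' ?_ .rfl
    filter_upwards [hkm, hky] with a h1 h2
    rw [← h1, ← h2]; push_cast; ring
  have hk' : (fun a => (k' a : ℝ) - τ / 2 * s a ^ 2) =O[l] s := by
    refine ((hm.sub hys).const_mul_left (1 / 2)).congr' ?_ .rfl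
    filter_upwards [hkm, hky] with a h1 h2
    rw [← h1, ← h2]; push_cast; ring
  have hτ2 : 0 < τ / 2 := by positivity
  have hmain : RelEq l (fun a => (s a)⁻¹)
      (fun a => Real.exp (((k a : ℝ) + k' a) * Real.log ((k a : ℝ) + k' a) -
        k a * Real.log (k a) - k' a * Real.log (k' a)))
      fun a => Real.exp (((k a : ℝ) + k' a) * Real.log 2 + -(y a ^ 2) / (2 * τ)) := by
    refine RelEq.exp ?_
    obtain ⟨Y, hY⟩ := hy.bound
    obtain ⟨C, hC⟩ := hm.bound
    refine IsBigO.of_bound (8 * Y ^ 3 / τ ^ 2 + C * Y ^ 2 / τ ^ 2) ?_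
    filter_upwards [hkm, hky, hY, hC, hs.eventually_gt_atTop 0, hs.eventually_ge_atTop (4 * Y / τ),
      eventually_le_of_sub_isBigO hs hτ hm, eventually_le_of_sub_isBigO hs hτ2 hk,
      eventually_le_of_sub_isBigO hs hτ2 hk'] with a h1 h2 h3 h4 h5 h6 h7 h8 h9
    have h1' : (m a : ℝ) = k a + k' a := by exact_mod_cast h1.symm
    rw [h1'] at h4 h7
    rw [norm_one, mul_one] at h3
    rw [Real.norm_eq_abs, Real.norm_eq_abs, abs_of_pos h5] at h4
    rw [norm_inv, Real.norm_of_nonneg h5.le]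
    refine abs_log_central_le ?_ ?_ h5 hτ h3 h2 h4 h7 ?_
    · exact lt_of_lt_of_le (by positivity) h8
    · exact lt_of_lt_of_le (by positivity) h9
    · rwa [div_le_iff₀ hτ, mul_comm (s a)] at h6
  have hfact := (relEq_factorial hs hτ hm).div
    ((relEq_factorial hs hτ2 hk).mul (relEq_factorial hs hτ2 hk'))
  have hcentral : RelEq l (fun a => (s a)⁻¹)
      (fun a => ((m a).factorial : ℝ) / ((k a).factorial * (k' a).factorial))
      fun a => √(2 / (Real.pi * (τ * s a ^ 2))) * (2 ^ m a * Real.exp (-(y a ^ 2) / (2 * τ))) := by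
    refine (hfact.trans (.of_eventuallyEq ?_)).trans
      ((hmain.mul_left fun a => √(2 / (Real.pi * (τ * s a ^ 2)))).trans (.of_eventuallyEq ?_))
    · filter_upwards [hkm, hs.eventually_gt_atTop 0] with a h1 h2
      have h1' : (m a : ℝ) = k a + k' a := by exact_mod_cast h1.symm
      rw [h1', mul_mul_mul_comm √(2 * Real.pi * (τ / 2 * s a ^ 2)), Real.mul_self_sqrt (by positivity),
        ← Real.exp_add, mul_div_mul_comm,
        ← Real.exp_sub]
      congr 1
      · rw [eq_comm, Real.sqrt_eq_iff_mul_self_eq (by positivity) (by positivity),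
          div_mul_div_comm, Real.mul_self_sqrt (by positivity)]
        field_simp
      · congr 1; ring
    · filter_upwards [hkm] with a h1
      have h1' : (m a : ℝ) = k a + k' a := by exact_mod_cast h1.symm
      rw [← h1', Real.exp_add, mul_comm (m a : ℝ), Real.exp_mul, Real.exp_log two_pos,
        Real.rpow_natCast]
  have hquot := hcentral.mul_left fun a =>
    (τ * s a ^ 2) ^ q / ((τ / 2 * s a ^ 2) ^ p * (τ / 2 * s a ^ 2) ^ p')
  refine ((relEq_factorial_add hs hτ hm q).div ((relEq_factorial_add hs hτ2 hk p).mul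
    (relEq_factorial_add hs hτ2 hk' p'))).trans ?_
  convert hquot using 2
  · rw [div_mul_div_comm]
    ring
  · ring

end Factorials

theorem prod_pow_two_mul_val (p : ℕ) (c : ℝ) :
    ∏ i : Fin p, c ^ (2 * (i : ℕ)) = (c ^ (p - 1)) ^ p := by
  rw [Finset.prod_pow_eq_pow_sum, ← Finset.mul_sum, Fin.sum_univ_eq_sum_range fun i => i, mul_comm,
    Finset.sum_range_id_mul_two, ← pow_mul, mul_comm]

theorem prod_prod_Ioi_sq (p : ℕ) (c : ℝ) :
    ∏ i : Fin p, ∏ _j ∈ Finset.Ioi i, c ^ 2 = (c ^ (p - 1)) ^ p := by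
  rw [← prod_pow_two_mul_val, ← Equiv.prod_comp Fin.revPerm]
  refine Finset.prod_congr rfl fun i _ => ?_
  rw [Finset.prod_const, Fin.card_Ioi, ← pow_mul]
  simp only [Fin.revPerm_apply, Fin.val_rev]
  congr 2
  omega

theorem factorial_two_mul (p : ℕ) :
    (2 * p).factorial = 2 ^ p * p.factorial * ∏ i : Fin p, (2 * (i : ℕ) + 1) := by
  induction p with
  | zero => simp
  | succ p ih =>
    rw [Fin.prod_univ_castSucc]
    simp only [Fin.val_castSucc, Fin.val_last]
    rw [show 2 * (p + 1) = 2 * p + 1 + 1 by ring, Nat.factorial_succ, Nat.factorial_succ, ih,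
      Nat.factorial_succ]
    ring

/-- The contribution of one branch to the asymptotic number of stars of length about `τ * s ^ 2`,
apart from the factors that depend on its endpoint. -/
noncomputable def starScale (p : ℕ) (τ s : ℝ) : ℝ :=
  √(2 / (Real.pi * (τ * s ^ 2))) * (τ * s ^ 2) ^ (p - 1) / (τ / 2 * s ^ 2) ^ (p + (p - 1))

section Stars

variable {α : Type*} {l : Filter α} {s : α → ℝ} {p : ℕ}

theorem relEq_card_starTo (hs : Tendsto s l atTop) {τ : ℝ} (hτ : 0 < τ) {m : α → ℕ}
    (hm : (fun a => (m a : ℝ) - τ * s a ^ 2) =O[l] s) {e : α → Fin p → ℤ} {y : α → Fin p → ℝ}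
    (hend : ∀ᶠ a in l, IsEndpoint (m a) (e a)) (hy : ∀ i, (fun a => y a i) =O[l] fun _ => (1 : ℝ))
    (hey : ∀ᶠ a in l, ∀ i, (e a i : ℝ) = y a i * s a) :
    RelEq l (fun a => (s a)⁻¹) (fun a => (Nat.card (StarTo p (m a) (e a)) : ℝ)) fun a =>
      (2 ^ m a * starScale p τ (s a)) ^ p *
        (∏ i, ((e a i : ℝ) + 1) * Real.exp (-(y a i ^ 2) / (2 * τ))) *
          ∏ i : Fin p, ∏ j ∈ Finset.Ioi i,
            (((e a j : ℝ) - e a i) * (e a i + e a j + 2) / 4) := by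
  let k : Fin p → α → ℕ := fun i a => ((m a + e a i) / 2).toNat
  let k' : Fin p → α → ℕ := fun i a => ((m a - e a i) / 2).toNat
  have hle : ∀ᶠ a in l, ∀ i, e a i ≤ m a := by
    refine eventually_all.2 fun i => ?_
    obtain ⟨Y, hY⟩ := (hy i).bound
    filter_upwards [hY, hey, eventually_le_of_sub_isBigO hs hτ hm, hs.eventually_gt_atTop 0,
      hs.eventually_ge_atTop (2 * Y / τ)] with a h1 h2 h3 h4 h5
    rw [norm_one, mul_one, Real.norm_eq_abs] at h1
    rw [div_le_iff₀ hτ] at h5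
    have h6 : (e a i : ℝ) ≤ m a := by
      rw [h2 i]
      nlinarith [(abs_le.1 h1).2]
    exact_mod_cast h6
  have hkk : ∀ᶠ a in l, ∀ i, k i a + k' i a = m a ∧ (k i a : ℤ) - k' i a = e a i := by
    filter_upwards [hle, hend] with a h1 h2 i
    have h3 := h1 i
    have h4 := h2.1 i
    have h5 := h2.2.2 i
    simp only [k, k']
    omega
  have hterm : ∀ i : Fin p, RelEq l (fun a => (s a)⁻¹)
      (fun a => ((e a i : ℝ) + 1) * (((m a + 2 * (i : ℕ)).factorial : ℝ) /
        ((k i a + p).factorial * (k' i a + (p - 1)).factorial)))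
      fun a => ((e a i : ℝ) + 1) * (2 ^ m a * (√(2 / (Real.pi * (τ * s a ^ 2))) *
        Real.exp (-(y a i ^ 2) / (2 * τ)) * ((τ * s a ^ 2) ^ (2 * (i : ℕ)) /
          ((τ / 2 * s a ^ 2) ^ p * (τ / 2 * s a ^ 2) ^ (p - 1))))) := by
    intro i
    refine RelEq.mul_left _ (relEq_factorial_div hs hτ ?_ hm (hy i) ?_ _ _ _)
    · filter_upwards [hkk] with a h using (h i).1
    · filter_upwards [hkk, hey] with a h1 h2
      rw [← h2 i, ← (h1 i).2]
      push_cast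
      ring
  have hprod := (RelEq.prod Finset.univ fun i _ => hterm i).mul (.of_eventuallyEq (EventuallyEq.refl
    l fun a => ∏ i : Fin p, ∏ j ∈ Finset.Ioi i,
      (((e a j : ℝ) - e a i) * (e a i + e a j + 2) / 4)))
  refine (RelEq.of_eventuallyEq ?_).trans (hprod.trans (.of_eventuallyEq (.of_forall fun a => ?_)))
  · filter_upwards [hkk, hend] with a h1 h2
    exact card_starTo h2 (fun i => k i a) (fun i => k' i a) (fun i => (h1 i).1) fun i => (h1 i).2
  · simp only [← pow_add]
    congr 1
    have : ∀ i : Fin p, ((e a i : ℝ) + 1) * (2 ^ m a * (√(2 / (Real.pi * (τ * s a ^ 2))) *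
        Real.exp (-(y a i ^ 2) / (2 * τ)) * ((τ * s a ^ 2) ^ (2 * (i : ℕ)) /
          (τ / 2 * s a ^ 2) ^ (p + (p - 1))))) =
        (2 ^ m a * √(2 / (Real.pi * (τ * s a ^ 2))) / (τ / 2 * s a ^ 2) ^ (p + (p - 1))) *
          (τ * s a ^ 2) ^ (2 * (i : ℕ)) *
            (((e a i : ℝ) + 1) * Real.exp (-(y a i ^ 2) / (2 * τ))) := fun i => by ring
    simp only [this]
    rw [Finset.prod_mul_distrib, Finset.prod_mul_distrib, prod_pow_two_mul_val, Finset.prod_const,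
      Finset.card_univ, Fintype.card_fin, ← mul_pow, starScale]
    congr 2
    ring

theorem relEq_add_const (hs : Tendsto s l atTop) {δ : ℝ} (hδ : 0 < δ) {g : α → ℝ}
    (hg : ∀ᶠ a in l, δ ≤ g a) (c : ℝ) :
    RelEq l (fun a => (s a)⁻¹) (fun a => g a * s a + c) fun a => g a * s a := by
  refine .of_div_sub_one hs.inv_tendsto_atTop ?_ (IsBigO.of_bound (|c| / δ) ?_)
  · filter_upwards [hg, hs.eventually_gt_atTop 0] with a h1 h2
    have := hδ.trans_le h1
    positivity
  · filter_upwards [hg, hs.eventually_gt_atTop 0] with a h1 h2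
    have := hδ.trans_le h1
    rw [add_div, div_self (by positivity), add_sub_cancel_left, norm_inv, norm_div, norm_mul,
      Real.norm_of_nonneg h2.le, Real.norm_of_nonneg this.le, Real.norm_eq_abs, ← div_div,
      div_eq_mul_inv]
    gcongr

/-- Asymptotics of the number of stars whose endpoints are of order `s`. -/
theorem relEq_card_starTo_of_le (hs : Tendsto s l atTop) {τ : ℝ} (hτ : 0 < τ) {m : α → ℕ}
    (hm : (fun a => (m a : ℝ) - τ * s a ^ 2) =O[l] s) {e : α → Fin p → ℤ} {x : α → Fin p → ℝ}
    (hend : ∀ᶠ a in l, IsEndpoint (m a) (e a)) (hx : ∀ i, (fun a => x a i) =O[l] fun _ => (1 : ℝ))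
    {δ : ℝ} (hδ : 0 < δ) (hδx : ∀ᶠ a in l, ∀ i, δ ≤ x a i)
    (hex : ∀ᶠ a in l, ∀ i, (e a i : ℝ) = x a i * s a) :
    RelEq l (fun a => (s a)⁻¹) (fun a => (Nat.card (StarTo p (m a) (e a)) : ℝ)) fun a =>
      (2 ^ m a * starScale p τ (s a)) ^ p *
        (∏ i, (x a i * s a) * Real.exp (-(x a i ^ 2) / (2 * τ))) *
          ∏ i : Fin p, ∏ j ∈ Finset.Ioi i, ((x a j ^ 2 - x a i ^ 2) * (s a ^ 2 / 4)) := by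
  refine (relEq_card_starTo hs hτ hm hend hx hex).trans ?_
  refine ((RelEq.prod _ fun i _ => RelEq.mul ?_ (.of_eventuallyEq .rfl)).mul_left _).mul
    (RelEq.prod _ fun i _ => RelEq.prod _ fun j _ => ?_)
  · refine (RelEq.of_eventuallyEq ?_).trans
      (relEq_add_const hs hδ (hδx.mono fun a h => h i) 1)
    filter_upwards [hex] with a h
    rw [h i]
  · have h1 := (relEq_add_const hs (add_pos hδ hδ)
      (hδx.mono fun a h => add_le_add (h i) (h j)) 2).mul_left fun a => (x a j - x a i) * s a / 4
    refine (RelEq.of_eventuallyEq ?_).trans (h1.trans (.of_eventuallyEq (.of_forall fun a => ?_)))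
    · filter_upwards [hex] with a h
      rw [h i, h j]
      ring
    · simp only
      ring

/-- Asymptotics of the number of stars that end where they started. -/
theorem relEq_card_starTo_two_mul (hs : Tendsto s l atTop) {m : α → ℕ} (heven : ∀ a, Even (m a))
    (hm : ∀ᶠ a in l, (m a : ℝ) = s a ^ 2) :
    RelEq l (fun a => (s a)⁻¹)
      (fun a => (Nat.card (StarTo p (m a) fun i => 2 * ((i : ℕ) : ℤ)) : ℝ)) fun a =>
      (2 ^ m a * starScale p 1 (s a)) ^ p * (∏ i : Fin p, (2 * ((i : ℕ) : ℝ) + 1)) *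
          ∏ i : Fin p, ∏ j ∈ Finset.Ioi i, ((((j : ℕ) : ℝ) - ((i : ℕ) : ℝ)) *
            (((j : ℕ) : ℝ) + ((i : ℕ) : ℝ) + 1)) := by
  have hO : ∀ c : ℝ, (fun a => c * (s a)⁻¹) =O[l] fun a => (s a)⁻¹ := fun c =>
    (isBigO_refl _ _).const_mul_left c
  have h1 : ∀ c : ℝ, (fun a => c * (s a)⁻¹) =O[l] fun _ => (1 : ℝ) := fun c =>
    (hO c).trans (hs.inv_tendsto_atTop.isBigO_one ℝ)
  have h := relEq_card_starTo (p := p) (τ := 1) hs one_pos (m := m)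
    (e := fun _ i => 2 * ((i : ℕ) : ℤ)) (y := fun a i => 2 * ((i : ℕ) : ℝ) * (s a)⁻¹) ?_ ?_
    (fun i => h1 _) ?_
  · refine h.trans (RelEq.mul (RelEq.mul_left _ (RelEq.prod _ fun i _ => ?_)) (.of_eventuallyEq
      (.of_forall fun a => ?_)))
    · have hexp : RelEq l (fun a => (s a)⁻¹)
          (fun a => Real.exp (-((2 * ((i : ℕ) : ℝ) * (s a)⁻¹) ^ 2) / (2 * 1)))
          fun _ => Real.exp 0 := by
        refine .exp ?_
        refine (((hO (2 * ((i : ℕ) : ℝ))).mul (h1 (2 * ((i : ℕ) : ℝ)))).const_mul_left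
          (-1 / 2)).congr (fun a => ?_) fun a => mul_one _
        ring
      refine (hexp.mul_left _).trans (.of_eventuallyEq (.of_forall fun a => ?_))
      simp
    · refine Finset.prod_congr rfl fun i _ => Finset.prod_congr rfl fun j _ => ?_
      push_cast
      ring
  · refine (isBigO_zero _ _).congr' ?_ .rfl
    filter_upwards [hm] with a ha
    rw [ha, one_mul, sub_self]
  · refine .of_forall fun a => ⟨fun i => by positivity, fun i j hij => ?_, fun i => ?_⟩
    · have : ((i : ℕ) : ℤ) < (j : ℕ) := by exact_mod_cast Fin.lt_def.1 hij
      change 2 * ((i : ℕ) : ℤ) < 2 * ((j : ℕ) : ℤ)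
      omega
    · obtain ⟨q, hq⟩ := heven a
      rw [hq]
      push_cast
      omega
  · filter_upwards [hs.eventually_gt_atTop 0] with a ha i
    push_cast
    field_simp

end Stars

/-- The powers of `s` in `starScale` combined. -/
theorem starScale_succ (q : ℕ) {τ s : ℝ} (hτ : 0 < τ) (hs : 0 < s) :
    starScale (q + 1) τ s =
      √2 * (2 ^ q) ^ 2 * 2 / (√Real.pi * √τ * s * (τ ^ (q + 1) * (s ^ 2) ^ (q + 1))) := by
  rw [starScale, Real.sqrt_div zero_le_two, Real.sqrt_mul Real.pi_pos.le, Real.sqrt_mul hτ.le,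
    Real.sqrt_sq hs.le, div_mul_eq_mul_div τ 2, div_pow, mul_pow, mul_pow, Nat.add_sub_cancel]
  field_simp
  ring

/-- The constants of the star asymptotics combine to the density `fW`. -/
theorem limit_eq_fW {p : ℕ} (hp : 1 ≤ p) {t : ℝ} (ht0 : 0 < t) (ht1 : t < 1) {x : Fin p → ℝ}
    (hx0 : ∀ i, 0 < x i) (hx : StrictMono x) {n m m' : ℕ} (hn : 0 < n) (hm : m + m' = 2 * n)
    {s : ℝ} (hs : s = √(2 * n)) :
    ((2 ^ m * starScale p t s) ^ p * (∏ i, (x i * s) * Real.exp (-(x i ^ 2) / (2 * t))) *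
        ∏ i : Fin p, ∏ j ∈ Finset.Ioi i, ((x j ^ 2 - x i ^ 2) * (s ^ 2 / 4))) *
      ((2 ^ m' * starScale p (1 - t) s) ^ p *
        (∏ i, (x i * s) * Real.exp (-(x i ^ 2) / (2 * (1 - t)))) *
        ∏ i : Fin p, ∏ j ∈ Finset.Ioi i, ((x j ^ 2 - x i ^ 2) * (s ^ 2 / 4))) /
      ((2 ^ (2 * n) * starScale p 1 s) ^ p * (∏ i : Fin p, (2 * ((i : ℕ) : ℝ) + 1)) *
          ∏ i : Fin p, ∏ j ∈ Finset.Ioi i, ((((j : ℕ) : ℝ) - ((i : ℕ) : ℝ)) *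
            (((j : ℕ) : ℝ) + ((i : ℕ) : ℝ) + 1))) =
      ((2 : ℝ) / n) ^ ((p : ℝ) / 2) * fW p t x := by
  have hn' : (0 : ℝ) < n := by exact_mod_cast hn
  have hs0 : 0 < s := by rw [hs]; positivity
  have hs2 : s ^ 2 = 2 * n := by rw [hs, Real.sq_sqrt (by positivity)]
  have ht1' : 0 < 1 - t := by linarith
  have hv : 0 < t * (1 - t) := by positivity
  have hhalf : ∀ c : ℝ, 0 ≤ c → c ^ ((p : ℝ) / 2) = √c ^ p := fun c hc => by
    rw [Real.sqrt_eq_rpow, ← Real.rpow_natCast, ← Real.rpow_mul hc]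
    congr 1
    ring
  have hsn : √((2 : ℝ) / n) = 2 / s := by
    rw [Real.sqrt_eq_iff_mul_self_eq (by positivity) (by positivity), ← pow_two, div_pow, hs2]
    field_simp
  have h2 : (2 : ℝ) ^ ((3 * (p : ℝ)) / 2) = (2 * √2) ^ p := by
    rw [show (3 * (p : ℝ)) / 2 = p + p / 2 by ring, Real.rpow_add two_pos, hhalf _ zero_le_two,
      Real.rpow_natCast, mul_pow]
  have hvp : (t * (1 - t)) ^ (-(((p : ℝ) ^ 2) + (p : ℝ) / 2)) =
      (((t * (1 - t)) ^ p * √(t * (1 - t))) ^ p)⁻¹ := by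
    rw [Real.rpow_neg hv.le, Real.rpow_add hv, hhalf _ hv.le, mul_pow, ← pow_mul, ← pow_two]
    norm_cast
  have hexp : Real.exp (-(∑ i, (x i) ^ 2) / (2 * t * (1 - t))) =
      (∏ i, Real.exp (-(x i ^ 2) / (2 * t))) * ∏ i, Real.exp (-(x i ^ 2) / (2 * (1 - t))) := by
    rw [← Real.exp_sum, ← Real.exp_sum, ← Real.exp_add]
    congr 1
    rw [← Finset.sum_add_distrib, ← Finset.sum_neg_distrib, Finset.sum_div]
    refine Finset.sum_congr rfl fun i _ => ?_
    field_simp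
    ring
  have hfac : ((2 * p).factorial : ℝ) =
      2 ^ p * p.factorial * ∏ i : Fin p, (2 * ((i : ℕ) : ℝ) + 1) := by
    rw [factorial_two_mul]
    push_cast
    rfl
  have hodd : (∏ i : Fin p, (2 * ((i : ℕ) : ℝ) + 1)) ≠ 0 :=
    Finset.prod_ne_zero_iff.2 fun i _ => by positivity
  have hvdm : (∏ i : Fin p, ∏ j ∈ Finset.Ioi i, ((((j : ℕ) : ℝ) - ((i : ℕ) : ℝ)) *
      (((j : ℕ) : ℝ) + ((i : ℕ) : ℝ) + 1))) ≠ 0 :=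
    Finset.prod_ne_zero_iff.2 fun i _ => Finset.prod_ne_zero_iff.2 fun j hj => by
      have : ((i : ℕ) : ℝ) < ((j : ℕ) : ℝ) := by exact_mod_cast Finset.mem_Ioi.1 hj
      have := sub_pos.2 this
      positivity
  have hchamber : (∀ i, 0 ≤ x i) ∧ (∀ i j : Fin p, i ≤ j → x i ≤ x j) :=
    ⟨fun i => (hx0 i).le, fun i j hij => hx.monotone hij⟩
  have hV : (∏ i : Fin p, ∏ j ∈ Finset.Ioi i, ((x j ^ 2 - x i ^ 2) * (s ^ 2 / 4))) ^ 2 =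
      (∏ i : Fin p, ∏ j ∈ Finset.Ioi i, (x j ^ 2 - x i ^ 2) ^ 2) *
        ((s ^ 2 / 4) ^ (p - 1)) ^ p := by
    rw [← prod_prod_Ioi_sq]
    simp only [← Finset.prod_mul_distrib, ← Finset.prod_pow, mul_pow]
  have hscale : 2 ^ m * starScale p t s * (2 ^ m' * starScale p (1 - t) s) * s ^ 2 *
      (s ^ 2 / 4) ^ (p - 1) * (√Real.pi * ((t * (1 - t)) ^ p * √(t * (1 - t)))) =
      2 / s * √2 * (2 ^ (2 * n) * starScale p 1 s) := by
    obtain ⟨q, rfl⟩ : ∃ q, p = q + 1 := ⟨p - 1, by omega⟩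
    rw [starScale_succ q ht0 hs0, starScale_succ q ht1' hs0, starScale_succ q one_pos hs0,
      Real.sqrt_mul ht0.le, ← hm, pow_add, Real.sqrt_one, Nat.add_sub_cancel, mul_pow, div_pow,
      one_pow, show (4 : ℝ) = 2 ^ 2 by norm_num, ← pow_mul 2 2 q, mul_comm 2 q, pow_mul 2 q 2]
    have h2q : √2 ^ 2 = (2 : ℝ) := Real.sq_sqrt zero_le_two
    generalize 1 - t = u at *
    field_simp
    ring
  have hpos : ∀ τ : ℝ, 0 < τ → 0 < starScale p τ s := fun τ hτ => by
    rw [starScale]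
    positivity
  have ha : 0 < 2 ^ m * starScale p t s := mul_pos (by positivity) (hpos t ht0)
  have hb : 0 < 2 ^ m' * starScale p (1 - t) s := mul_pos (by positivity) (hpos _ ht1')
  have hr : 0 < (s ^ 2 / 4) ^ (p - 1) := by positivity
  have hw : 0 < (t * (1 - t)) ^ p * √(t * (1 - t)) := by positivity
  have hc := eq_div_of_mul_eq (by positivity) ((mul_comm _ _).trans hscale.symm)
  rw [fW, if_pos hchamber, cW, h2, hvp, hexp, hfac, hhalf _ (by positivity), hsn,
    hhalf _ Real.pi_pos.le, hc]
  simp only [Finset.prod_mul_distrib (g := fun i => Real.exp _)]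
  simp only [Finset.prod_mul_distrib (f := x), Finset.prod_const, Finset.card_univ,
    Fintype.card_fin, Finset.prod_pow] at hV ⊢
  generalize (∏ i : Fin p, ∏ j ∈ Finset.Ioi i, ((x j ^ 2 - x i ^ 2) * (s ^ 2 / 4))) = V at *
  generalize (∏ i : Fin p, ∏ j ∈ Finset.Ioi i, (x j ^ 2 - x i ^ 2)) = V' at *
  generalize (∏ i : Fin p, ∏ j ∈ Finset.Ioi i, ((((j : ℕ) : ℝ) - ((i : ℕ) : ℝ)) *
    (((j : ℕ) : ℝ) + ((i : ℕ) : ℝ) + 1))) = D at *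
  generalize (∏ i : Fin p, (2 * ((i : ℕ) : ℝ) + 1)) = O at *
  generalize 2 ^ m * starScale p t s = a at *
  generalize 2 ^ m' * starScale p (1 - t) s = b at *
  generalize (s ^ 2 / 4) ^ (p - 1) = r at *
  generalize (t * (1 - t)) ^ p * √(t * (1 - t)) = w at *
  generalize (∏ i, x i) = X
  generalize (∏ i, Real.exp (-x i ^ 2 / (2 * t))) = E
  generalize (∏ i, Real.exp (-x i ^ 2 / (2 * (1 - t)))) = E'
  simp only [mul_pow, div_pow]
  field_simp
  rw [hV]
  ring

theorem fW_pos {p : ℕ} {t : ℝ} (ht0 : 0 < t) (ht1 : t < 1) {x : Fin p → ℝ} (hx0 : ∀ i, 0 < x i)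
    (hx : StrictMono x) : 0 < fW p t x := by
  have hv : 0 < t * (1 - t) := mul_pos ht0 (sub_pos.2 ht1)
  have hvdm : 0 < ∏ i : Fin p, ∏ j ∈ Finset.Ioi i, ((((j : ℕ) : ℝ) - ((i : ℕ) : ℝ)) *
      (((j : ℕ) : ℝ) + ((i : ℕ) : ℝ) + 1)) :=
    Finset.prod_pos fun i _ => Finset.prod_pos fun j hj => by
      have : ((i : ℕ) : ℝ) < ((j : ℕ) : ℝ) := by exact_mod_cast Finset.mem_Ioi.1 hj
      have := sub_pos.2 this
      positivity
  have hc : 0 < cW p := by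
    rw [cW]
    have := Real.pi_pos
    positivity
  have hV : 0 < ∏ i : Fin p, ∏ j ∈ Finset.Ioi i, (x j ^ 2 - x i ^ 2) ^ 2 :=
    Finset.prod_pos fun i _ => Finset.prod_pos fun j hj =>
      pow_pos (sub_pos.2 (pow_lt_pow_left₀ (hx (Finset.mem_Ioi.1 hj)) (hx0 i).le two_ne_zero)) 2
  have hX : 0 < ∏ i, x i ^ 2 := Finset.prod_pos fun i _ => pow_pos (hx0 i) 2
  rw [fW, if_pos ⟨fun i => (hx0 i).le, fun i j hij => hx.monotone hij⟩]
  positivity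

/-- Compact subsets of the chamber stay away from its boundary and from infinity. -/
theorem IsCompact.exists_bounds_of_pos {p : ℕ} {K : Set (Fin p → ℝ)} (hK : IsCompact K)
    (hpos : ∀ x ∈ K, ∀ i, 0 < x i) :
    ∃ δ > 0, ∃ R : ℝ, ∀ x ∈ K, ∀ i, δ ≤ x i ∧ x i ≤ R := by
  rcases K.eq_empty_or_nonempty with rfl | hne
  · exact ⟨1, one_pos, 0, fun x hx => hx.elim⟩
  choose y hyK hy using fun i : Fin p => hK.exists_isMinOn hne (continuous_apply i).continuousOn
  obtain ⟨R, hR⟩ := hK.isBounded.exists_norm_le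
  obtain ⟨δ, hδ, hδy⟩ : ∃ δ > 0, ∀ i, δ ≤ y i i := by
    rcases isEmpty_or_nonempty (Fin p) with h | h
    · exact ⟨1, one_pos, fun i => h.elim i⟩
    · obtain ⟨i, hi⟩ := Finite.exists_min fun i => y i i
      exact ⟨_, hpos _ (hyK i) i, hi⟩
  exact ⟨δ, hδ, R, fun x hx i => ⟨(hδy i).trans (isMinOn_iff.1 (hy i) x hx),
    (le_abs_self _).trans ((norm_le_pi_norm x i).trans (hR x hx))⟩⟩

/-- uniform local limit estimate on compact subsets of the open
chamber `{0 < x_1 < ... < x_p}` for watermelons with wall condition. -/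
theorem melonW_local_limit (p : ℕ) (hp : 1 ≤ p) (t : ℝ) (ht0 : 0 < t) (ht1 : t < 1)
    (K : Set (Fin p → ℝ)) (hK : IsCompact K)
    (hKsub : K ⊆ {x | (∀ i, 0 < x i) ∧ StrictMono x}) :
    ∃ C > (0 : ℝ), ∃ n₀ : ℕ, ∀ n : ℕ, n₀ ≤ n → ∀ x ∈ K,
      (∀ i : Fin p, ∃ z : ℤ, (z : ℝ) = x i * Real.sqrt (2 * n) ∧
        (z - (⌊2 * (n : ℝ) * t⌋₊ : ℤ)) % 2 = 0) →
      |probW p n (fun w => ∀ i, (w i ⌊2 * (n : ℝ) * t⌋₊ : ℝ) = x i * Real.sqrt (2 * n)) /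
          (((2 : ℝ) / (n : ℝ)) ^ ((p : ℝ) / 2) * fW p t x) - 1|
        ≤ C / Real.sqrt n := by
  obtain ⟨δ, hδ, R, hbd⟩ := hK.exists_bounds_of_pos fun x hx => (hKsub hx).1
  let S : Set (ℕ × (Fin p → ℝ)) := {a | a.2 ∈ K ∧ ∀ i : Fin p, ∃ z : ℤ,
    (z : ℝ) = a.2 i * Real.sqrt (2 * a.1) ∧ (z - (⌊2 * (a.1 : ℝ) * t⌋₊ : ℤ)) % 2 = 0}
  let l : Filter (ℕ × (Fin p → ℝ)) := comap Prod.fst atTop ⊓ 𝓟 S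
  let s : ℕ × (Fin p → ℝ) → ℝ := fun a => √(2 * a.1)
  let m : ℕ × (Fin p → ℝ) → ℕ := fun a => ⌊2 * (a.1 : ℝ) * t⌋₊
  let e : ℕ × (Fin p → ℝ) → Fin p → ℤ := fun a i => ⌊a.2 i * s a⌋
  have hS : ∀ᶠ a in l, a ∈ S := eventually_inf_principal.2 (.of_forall fun _ h => h)
  have hfst : Tendsto (fun a : ℕ × (Fin p → ℝ) => a.1) l atTop :=
    tendsto_comap.mono_left inf_le_left
  have hn : ∀ᶠ a in l, 0 < a.1 := hfst.eventually_gt_atTop 0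
  have hs : Tendsto s l atTop := Real.tendsto_sqrt_atTop.comp
    ((tendsto_natCast_atTop_atTop.comp hfst).const_mul_atTop two_pos)
  have hs2 : ∀ a, s a ^ 2 = 2 * a.1 := fun a => Real.sq_sqrt (by positivity)
  have hmle : ∀ a, m a ≤ 2 * a.1 := fun a => by
    refine Nat.floor_le_of_le ?_
    push_cast
    exact mul_le_of_le_one_right (by positivity) ht1.le
  have hm1 : ∀ a, |(m a : ℝ) - t * s a ^ 2| ≤ 1 := fun a => by
    have h1 := Nat.floor_le (a := 2 * (a.1 : ℝ) * t) (by positivity)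
    have h2 := Nat.lt_floor_add_one (2 * (a.1 : ℝ) * t)
    rw [hs2, abs_le]
    constructor <;> simp only [m] <;> linarith
  have hm : (fun a => (m a : ℝ) - t * s a ^ 2) =O[l] s :=
    (IsBigO.of_bound (g := fun _ => (1 : ℝ)) 1 (.of_forall fun a => by simpa using hm1 a)).trans
      (isBigO_one_of_tendsto_atTop hs 1)
  have hm' : (fun a => ((2 * a.1 - m a : ℕ) : ℝ) - (1 - t) * s a ^ 2) =O[l] s := by
    refine hm.neg_left.congr_left fun a => ?_
    rw [Nat.cast_sub (hmle a), hs2]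
    push_cast
    ring
  have he : ∀ a ∈ S, ∀ i, (e a i : ℝ) = a.2 i * s a ∧ (e a i - (m a : ℤ)) % 2 = 0 := by
    rintro a ⟨-, ha⟩ i
    obtain ⟨z, hz, hz2⟩ := ha i
    have : e a i = z := by simp only [e, s, ← hz, Int.floor_intCast]
    rw [this]
    exact ⟨hz, hz2⟩
  have hex : ∀ᶠ a in l, ∀ i, (e a i : ℝ) = a.2 i * s a := hS.mono fun a ha i => (he a ha i).1
  have hend : ∀ m' : ℕ × (Fin p → ℝ) → ℕ, (∀ a, ((m' a : ℤ) - m a) % 2 = 0) →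
      ∀ᶠ a in l, IsEndpoint (m' a) (e a) := by
    intro m' hm'
    filter_upwards [hS, hs.eventually_gt_atTop 0] with a ha hsa
    obtain ⟨hx0, hx⟩ := hKsub ha.1
    refine ⟨fun i => ?_, fun i j hij => ?_, fun i => ?_⟩
    · have := mul_pos (hx0 i) hsa
      rw [← (he a ha i).1] at this
      exact_mod_cast this.le
    · have := mul_lt_mul_of_pos_right (hx hij) hsa
      rw [← (he a ha i).1, ← (he a ha j).1] at this
      exact_mod_cast this
    · have h1 := (he a ha i).2
      have h2 := hm' a
      omega
  have hx : ∀ i, (fun a : ℕ × (Fin p → ℝ) => a.2 i) =O[l] fun _ => (1 : ℝ) := fun i => by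
    refine IsBigO.of_bound R ?_
    filter_upwards [hS] with a ha
    have := hbd _ ha.1 i
    rw [norm_one, mul_one, Real.norm_of_nonneg (hδ.le.trans this.1)]
    exact this.2
  have hδx : ∀ᶠ a in l, ∀ i, δ ≤ a.2 i := hS.mono fun a ha i => (hbd _ ha.1 i).1
  have hrel : RelEq l (fun a => (s a)⁻¹)
      (fun a => probW p a.1 fun w => ∀ i, (w i (m a) : ℝ) = a.2 i * s a)
      fun a => ((2 : ℝ) / a.1) ^ ((p : ℝ) / 2) * fW p t a.2 := by
    have h1 := relEq_card_starTo_of_le hs ht0 hm (hend m fun a => by simp) hx hδ hδx hex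
    have h2 := relEq_card_starTo_of_le hs (sub_pos.2 ht1) hm' (hend _ fun a => by
      have := hmle a
      omega) hx hδ hδx hex
    have h3 := relEq_card_starTo_two_mul (p := p) hs (m := fun a => 2 * a.1)
      (fun a => even_two_mul _) (.of_forall fun a => by rw [hs2]; push_cast; rfl)
    refine (RelEq.of_eventuallyEq ?_).trans (((h1.mul h2).div h3).trans (.of_eventuallyEq ?_))
    · filter_upwards [hex] with a ha
      rw [← probW_eq (hmle a)]
      simp only [← ha, Int.cast_inj]
    · filter_upwards [hS, hn] with a ha hna
      obtain ⟨hx0, hx⟩ := hKsub ha.1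
      exact limit_eq_fW hp ht0 ht1 hx0 hx hna (Nat.add_sub_of_le (hmle a)) rfl
  have hne : ∀ᶠ a in l, ((2 : ℝ) / a.1) ^ ((p : ℝ) / 2) * fW p t a.2 ≠ 0 := by
    filter_upwards [hS, hn] with a ha hna
    obtain ⟨hx0, hx⟩ := hKsub ha.1
    have := fW_pos ht0 ht1 hx0 hx
    positivity
  obtain ⟨C, hC, hbound⟩ := (hrel.isBigO_div_sub_one hs.inv_tendsto_atTop hne).exists_pos
  obtain ⟨N, hN⟩ := eventually_atTop.1
    (eventually_comap.1 (eventually_inf_principal.1 hbound.bound))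
  refine ⟨C, hC, N + 1, fun n hnN x hxK hlat => ?_⟩
  refine (hN n (by omega) (n, x) rfl ⟨hxK, hlat⟩).trans ?_
  have hn0 : (0 : ℝ) < n := by exact_mod_cast (show 0 < n by omega)
  rw [Pi.inv_apply, norm_inv, Real.norm_of_nonneg (Real.sqrt_nonneg _), ← div_eq_mul_inv]
  have : √(n : ℝ) ≤ √(2 * n) := Real.sqrt_le_sqrt (by linarith)
  have := Real.sqrt_pos.2 hn0
  change C / √(2 * (n : ℝ)) ≤ _
  gcongr
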